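/- Fix an integer n ≥ 1. Suppose N ≤ n and Ñ ≤ n are nonnegative integers, β_1 > β_2 > ⋯ > β_N > 0 and β̃_1 > β̃_2 > ⋯ > β̃_Ñ > 0 are strictly decreasing lists of positive reals, and Σ_{m=1}^{N} β_m^{2k+1} = Σ_{m=1}^{Ñ} β̃_m^{2k+1} for every k = 1, …, n. Then N = Ñ and β_m = β̃_m for all m. (Equivalently: given constraints e_1, …, e_n, there is at most one choice of N ≤ n and β_1 > ⋯ > β_N > 0 whose first n odd power sums, suitably scaled, equal e_1, …, e_n.) -/

import Mathlib

open Polynomial in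
theorem exists_sign_poly (a b : ℕ → ℝ) (ha : Antitone a) (hb : Antitone b) (n : ℕ) :
    ∃ R : ℝ[X], R ≠ 0 ∧ R.natDegree ≤ n ∧
      (∀ j ≤ n, (b j ≤ a j → ∀ u, b j ≤ u → u ≤ a j → 0 ≤ R.eval u) ∧
        (a j < b j → ∀ u, a j ≤ u → u ≤ b j → R.eval u ≤ 0)) ∧
      (b n ≤ a n → ∀ u, u ≤ a n → 0 ≤ R.eval u) ∧
      (a n < b n → ∀ u, u ≤ b n → R.eval u ≤ 0) := by
  induction n with
  | zero =>
    rcases le_or_gt (b 0) (a 0) with h | h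
    · refine ⟨1, one_ne_zero, by simp, ?_, ?_, ?_⟩
      · intro j hj
        obtain rfl : j = 0 := by omega
        exact ⟨fun _ u _ _ => by simp, fun h' => absurd h (not_le.2 h')⟩
      · intro _ u _; simp
      · intro h'; exact absurd h (not_le.2 h')
    · refine ⟨-1, by simp, by simp, ?_, ?_, ?_⟩
      · intro j hj
        obtain rfl : j = 0 := by omega
        exact ⟨fun h' => absurd h' (not_le.2 h), fun _ u _ _ => by simp⟩
      · intro h'; exact absurd h' (not_le.2 h)
      · intro _ u _; simp
  | succ n ih =>
    obtain ⟨R, hR0, hRd, hR, hp, hm⟩ := ih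
    have ha1 := ha (Nat.le_succ n)
    have hb1 := hb (Nat.le_succ n)
    simp only [Nat.succ_eq_add_one] at ha1 hb1
    have key : ∀ S : ℝ[X], S ≠ 0 → S.natDegree ≤ n + 1 →
      (∀ j ≤ n, (b j ≤ a j → ∀ u, b j ≤ u → u ≤ a j → 0 ≤ S.eval u) ∧
        (a j < b j → ∀ u, a j ≤ u → u ≤ b j → S.eval u ≤ 0)) →
      (b (n+1) ≤ a (n+1) → ∀ u, u ≤ a (n+1) → 0 ≤ S.eval u) →
      (a (n+1) < b (n+1) → ∀ u, u ≤ b (n+1) → S.eval u ≤ 0) →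
      ∃ R : ℝ[X], R ≠ 0 ∧ R.natDegree ≤ n + 1 ∧
      (∀ j ≤ n + 1, (b j ≤ a j → ∀ u, b j ≤ u → u ≤ a j → 0 ≤ R.eval u) ∧
        (a j < b j → ∀ u, a j ≤ u → u ≤ b j → R.eval u ≤ 0)) ∧
      (b (n+1) ≤ a (n+1) → ∀ u, u ≤ a (n+1) → 0 ≤ R.eval u) ∧
      (a (n+1) < b (n+1) → ∀ u, u ≤ b (n+1) → R.eval u ≤ 0) := by
      intro S h0 hd h1 h2 h3
      refine ⟨S, h0, hd, ?_, h2, h3⟩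
      intro j hj
      rcases Nat.lt_or_ge n j with h | h
      · obtain rfl : j = n + 1 := by omega
        exact ⟨fun h u _ hu => h2 h u hu, fun h u _ hu => h3 h u hu⟩
      · exact h1 j h
    have hdeg : ∀ c : ℝ, (R * (X - C c)).natDegree ≤ n + 1 := fun c =>
      natDegree_mul_le.trans (by rw [natDegree_X_sub_C]; omega)
    rcases le_or_gt (b n) (a n) with h | h
    · rcases le_or_gt (b (n+1)) (a (n+1)) with h' | h'
      · exact key R hR0 (by omega) hR (fun _ u hu => hp h u (hu.trans ha1))
          (fun h2 => absurd h' (not_le.2 h2))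
      · refine key (R * (X - C (b n))) (mul_ne_zero hR0 (X_sub_C_ne_zero _)) (hdeg _) ?_
          (fun h2 => absurd h2 (not_le.2 h')) ?_
        · intro j hj
          have := hb hj
          refine ⟨fun h1 u hu hu' => ?_, fun h1 u hu hu' => ?_⟩
          · have := (hR j hj).1 h1 u hu hu'
            simp only [eval_mul, eval_sub, eval_X, eval_C]
            exact mul_nonneg this (by linarith)
          · have := (hR j hj).2 h1 u hu hu'
            have := ha hj
            simp only [eval_mul, eval_sub, eval_X, eval_C]
            exact mul_nonpos_of_nonpos_of_nonneg ‹_› (by linarith)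
        · intro _ u hu
          have := hp h u (by linarith)
          simp only [eval_mul, eval_sub, eval_X, eval_C]
          exact mul_nonpos_of_nonneg_of_nonpos this (by linarith)
    · rcases le_or_gt (b (n+1)) (a (n+1)) with h' | h'
      · refine key (R * (X - C (a n))) (mul_ne_zero hR0 (X_sub_C_ne_zero _)) (hdeg _) ?_
          ?_ (fun h2 => absurd h' (not_le.2 h2))
        · intro j hj
          have := hb hj
          have := ha hj
          refine ⟨fun h1 u hu hu' => ?_, fun h1 u hu hu' => ?_⟩
          · have := (hR j hj).1 h1 u hu hu'
            simp only [eval_mul, eval_sub, eval_X, eval_C]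
            exact mul_nonneg this (by linarith)
          · have := (hR j hj).2 h1 u hu hu'
            simp only [eval_mul, eval_sub, eval_X, eval_C]
            exact mul_nonpos_of_nonpos_of_nonneg ‹_› (by linarith)
        · intro _ u hu
          have := hm h u (by linarith)
          simp only [eval_mul, eval_sub, eval_X, eval_C]
          exact mul_nonneg_of_nonpos_of_nonpos this (by linarith)
      · exact key R hR0 (by omega) hR (fun h2 => absurd h2 (not_le.2 h'))
          (fun _ u hu => hm h u (hu.trans hb1))

/-- Odd antiderivative of `t ^ 2 * R (t ^ 2)`. -/
noncomputable def oddPrim (R : Polynomial ℝ) (n : ℕ) (t : ℝ) : ℝ :=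
  ∑ k ∈ Finset.range n, R.coeff k / (2 * k + 3) * t ^ (2 * (k + 1) + 1)

theorem oddPrim_hasDerivAt (R : Polynomial ℝ) (n : ℕ) (hn : R.natDegree < n) (t : ℝ) :
    HasDerivAt (oddPrim R n) (t ^ 2 * R.eval (t ^ 2)) t := by
  have h : HasDerivAt (oddPrim R n) (∑ k ∈ Finset.range n,
      R.coeff k / (2 * k + 3) * (((2 * (k + 1) + 1 : ℕ) : ℝ) * t ^ (2 * (k + 1) + 1 - 1))) t := by
    unfold oddPrim
    exact HasDerivAt.fun_sum fun k _ => (hasDerivAt_pow _ t).const_mul _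
  convert h using 1
  rw [Polynomial.eval_eq_sum_range' hn, Finset.mul_sum]
  refine Finset.sum_congr rfl fun k _ => ?_
  have : (2 * (k:ℝ) + 3) ≠ 0 := by positivity
  rw [Nat.add_sub_cancel]
  push_cast
  field_simp
  ring

theorem oddPrim_mono (R : Polynomial ℝ) (n : ℕ) (hn : R.natDegree < n) (hR : R ≠ 0)
    (a b : ℝ) (ha : 0 ≤ a) (hab : a < b)
    (h : ∀ t, a ≤ t → t ≤ b → 0 ≤ R.eval (t ^ 2)) : oddPrim R n a < oddPrim R n b := by
  have hd := oddPrim_hasDerivAt R n hn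
  have hmono : MonotoneOn (oddPrim R n) (Set.Icc a b) := by
    apply monotoneOn_of_deriv_nonneg (convex_Icc a b)
    · exact fun t _ => (hd t).continuousAt.continuousWithinAt
    · exact fun t _ => (hd t).differentiableAt.differentiableWithinAt
    · intro t ht
      have ht := interior_subset ht
      rw [(hd t).deriv]
      exact mul_nonneg (sq_nonneg t) (h t ht.1 ht.2)
  have hle := hmono (Set.left_mem_Icc.2 hab.le) (Set.right_mem_Icc.2 hab.le) hab.le
  refine lt_of_le_of_ne hle fun heq => hR ?_
  have hz : ∀ t ∈ Set.Ioo a b, R.eval (t ^ 2) = 0 := by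
    intro t ht
    have he : oddPrim R n =ᶠ[nhds t] fun _ => oddPrim R n a := by
      filter_upwards [isOpen_Ioo.mem_nhds ht] with s hs
      have hs' : s ∈ Set.Icc a b := ⟨hs.1.le, hs.2.le⟩
      have h1 := hmono (Set.left_mem_Icc.2 hab.le) hs' hs'.1
      have h2 := hmono hs' (Set.right_mem_Icc.2 hab.le) hs'.2
      linarith
    have h0 := (hd t).unique ((hasDerivAt_const t (oddPrim R n a)).congr_of_eventuallyEq he)
    have : 0 < t := ha.trans_lt ht.1
    exact (mul_eq_zero.1 h0).resolve_left (by positivity)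
  apply Polynomial.eq_zero_of_infinite_isRoot
  have hinf : ((fun t : ℝ => t ^ 2) '' Set.Ioo a b).Infinite := by
    apply (Set.Ioo_infinite hab).image
    intro x hx y hy hxy
    exact (pow_left_inj₀ (ha.trans hx.1.le) (ha.trans hy.1.le) two_ne_zero).1 hxy
  refine hinf.mono ?_
  rintro _ ⟨t, ht, rfl⟩
  exact hz t ht

theorem oddPrim_neg (R : Polynomial ℝ) (n : ℕ) (t : ℝ) : oddPrim (-R) n t = - oddPrim R n t := by
  simp [oddPrim, neg_div]

theorem eq_of_odd_sums (n : ℕ) (x y : ℕ → ℝ) (hx : Antitone x) (hy : Antitone y)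
    (hx0 : ∀ i, 0 ≤ x i) (hy0 : ∀ i, 0 ≤ y i)
    (h : ∀ k : ℕ, 1 ≤ k → k ≤ n →
      ∑ i ∈ Finset.range n, x i ^ (2 * k + 1) = ∑ i ∈ Finset.range n, y i ^ (2 * k + 1)) :
    ∀ i < n, x i = y i := by
  rcases n with _ | n
  · intro i hi; omega
  obtain ⟨R, hR0, hRd, hR, -, -⟩ := exists_sign_poly (fun i => x i ^ 2) (fun i => y i ^ 2)
    (fun i j hij => pow_le_pow_left₀ (hx0 j) (hx hij) 2)
    (fun i j hij => pow_le_pow_left₀ (hy0 j) (hy hij) 2) n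
  have hsum : ∑ i ∈ Finset.range (n+1), oddPrim R (n+1) (x i)
      = ∑ i ∈ Finset.range (n+1), oddPrim R (n+1) (y i) := by
    unfold oddPrim
    refine Finset.sum_comm.trans (Eq.trans ?_ Finset.sum_comm)
    refine Finset.sum_congr rfl fun k hk => ?_
    rw [Finset.mem_range] at hk
    rw [← Finset.mul_sum, ← Finset.mul_sum, h (k+1) (by omega) (by omega)]
  have hlt : ∀ i < n + 1, x i ≠ y i → oddPrim R (n+1) (y i) < oddPrim R (n+1) (x i) := by
    intro i hi hne
    have hi' := hR i (by omega)
    rcases lt_or_gt_of_ne hne with hl | hl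
    · have := oddPrim_mono (-R) (n+1) (by rw [Polynomial.natDegree_neg]; omega)
        (neg_ne_zero.2 hR0) (x i) (y i) (hx0 i) hl (fun t h1 h2 => by
          have := hi'.2 (pow_lt_pow_left₀ hl (hx0 i) two_ne_zero) (t^2)
            (pow_le_pow_left₀ (hx0 i) h1 2) (pow_le_pow_left₀ ((hx0 i).trans h1) h2 2)
          simpa using this)
      rw [oddPrim_neg, oddPrim_neg] at this
      linarith
    · exact oddPrim_mono R (n+1) (by omega) hR0 (y i) (x i) (hy0 i) hl (fun t h1 h2 =>
        hi'.1 (pow_le_pow_left₀ (hy0 i) hl.le 2) (t^2)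
          (pow_le_pow_left₀ (hy0 i) h1 2) (pow_le_pow_left₀ ((hy0 i).trans h1) h2 2))
  intro i hi
  by_contra hne
  have : ∑ i ∈ Finset.range (n+1), oddPrim R (n+1) (y i)
      < ∑ i ∈ Finset.range (n+1), oddPrim R (n+1) (x i) := by
    apply Finset.sum_lt_sum
    · intro j hj
      by_cases hj' : x j = y j
      · rw [hj']
      · exact (hlt j (Finset.mem_range.1 hj) hj').le
    · exact ⟨i, Finset.mem_range.2 hi, hlt i hi hne⟩
  linarith

/-- Extension of a finite list by zeros. -/
noncomputable def padZ {N : ℕ} (β : Fin N → ℝ) (i : ℕ) : ℝ := if h : i < N then β ⟨i, h⟩ else 0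

theorem padZ_nonneg {N : ℕ} (β : Fin N → ℝ) (h : ∀ m, 0 < β m) (i : ℕ) : 0 ≤ padZ β i := by
  unfold padZ
  split_ifs
  · exact (h _).le
  · exact le_rfl

theorem padZ_anti {N : ℕ} (β : Fin N → ℝ) (h : ∀ m, 0 < β m) (ha : StrictAnti β) :
    Antitone (padZ β) := by
  intro i j hij
  by_cases hj : j < N
  · have hi : i < N := by omega
    simp only [padZ, hi, hj, dif_pos]
    exact ha.antitone hij
  · have : padZ β j = 0 := by simp [padZ, hj]
    rw [this]
    exact padZ_nonneg β h i

theorem padZ_sum {N : ℕ} (β : Fin N → ℝ) (n : ℕ) (hN : N ≤ n) (k : ℕ) :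
    ∑ i ∈ Finset.range n, padZ β i ^ (2 * k + 1) = ∑ m, β m ^ (2 * k + 1) := by
  rw [← Finset.sum_subset (Finset.range_subset_range.2 hN), Finset.sum_range]
  · refine Finset.sum_congr rfl fun m _ => ?_
    simp [padZ]
  · intro i _ hi
    have : ¬ i < N := by simpa using hi
    simp [padZ, this]

/-- **Uniqueness of multisoliton parameters (distinct case).**
Fix `n ≥ 1`.  If `N ≤ n` and `N' ≤ n`, `β : Fin N → ℝ` and `β' : Fin N' → ℝ` are strictly
decreasing lists of positive reals whose odd power sums `∑ β_m ^ (2k+1)` agree for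
`k = 1, …, n`, then `N = N'` and `β = β'`. -/
theorem stmt_0 (n : ℕ) (hn : 1 ≤ n) (N N' : ℕ) (hN : N ≤ n) (hN' : N' ≤ n)
    (β : Fin N → ℝ) (β' : Fin N' → ℝ)
    (hβpos : ∀ m, 0 < β m) (hβanti : StrictAnti β)
    (hβ'pos : ∀ m, 0 < β' m) (hβ'anti : StrictAnti β')
    (hsum : ∀ k : ℕ, 1 ≤ k → k ≤ n →
      ∑ m, β m ^ (2 * k + 1) = ∑ m, β' m ^ (2 * k + 1)) :
    ∃ h : N = N', ∀ m : Fin N, β m = β' (Fin.cast h m) := by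
  have key := eq_of_odd_sums n (padZ β) (padZ β') (padZ_anti β hβpos hβanti)
    (padZ_anti β' hβ'pos hβ'anti) (padZ_nonneg β hβpos) (padZ_nonneg β' hβ'pos)
    (fun k h1 h2 => by rw [padZ_sum β n hN, padZ_sum β' n hN', hsum k h1 h2])
  have hNN : N = N' := by
    rcases lt_trichotomy N N' with h | h | h
    · have h1 := key N (by omega)
      have h2 := hβ'pos ⟨N, h⟩
      simp only [padZ, h, lt_irrefl, dif_pos, dif_neg, not_false_eq_true] at h1
      linarith
    · exact h
    · have h1 := key N' (by omega)
      have h2 := hβpos ⟨N', h⟩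
      simp only [padZ, h, lt_irrefl, dif_pos, dif_neg, not_false_eq_true] at h1
      linarith
  subst hNN
  refine ⟨rfl, fun m => ?_⟩
  have h1 := key m (by omega)
  simpa [padZ] using h1
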